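/- Let A = GF(p) with p prime. The classes of operations on A stable under both left and right composition with the clone L of affine functions are exactly: the empty set, the classes D_k of operations of degree at most k for each k ∈ ℕ, and the class of all operations. -/

import Mathlib

/-- A finitary operation, with positive arity. -/
abbrev OpSig (A B : Type*) := Σ n : ℕ, (Fin (n + 1) → A) → B

/-- Composition of function classes. -/
def classComp {A B C : Type*} (F : Set (OpSig B C)) (K : Set (OpSig A B)) :
    Set (OpSig A C) :=
  { h | ∃ (n m : ℕ) (f : (Fin (n + 1) → B) → C)
      (g : Fin (n + 1) → (Fin (m + 1) → A) → B),
      (⟨n, f⟩ : OpSig B C) ∈ F ∧ (∀ i, (⟨m, g i⟩ : OpSig A B) ∈ K) ∧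
      h = ⟨m, fun a => f fun i => g i a⟩ }

/-- `f` has degree at most `k`. -/
def HasDegLE {F : Type*} [CommSemiring F] {n : ℕ} (f : (Fin n → F) → F)
    (k : ℕ) : Prop :=
  ∃ q : MvPolynomial (Fin n) F, q.totalDegree ≤ k ∧ ∀ a, MvPolynomial.eval a q = f a

/-- The class `D_k` of operations of degree at most `k`. -/
def degClass (F : Type*) [CommSemiring F] (k : ℕ) : Set (OpSig F F) :=
  { g | HasDegLE g.2 k }

/-- The clone `L` of affine operations. -/
def affineClass (F : Type*) [CommSemiring F] : Set (OpSig F F) :=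
  degClass F 1

section helpers
open Finset

theorem hd_mono {F : Type*} [CommSemiring F] {n : ℕ} {f : (Fin n → F) → F} {k l : ℕ}
    (h : HasDegLE f k) (hkl : k ≤ l) : HasDegLE f l := by
  obtain ⟨q, hq, h⟩ := h
  exact ⟨q, hq.trans hkl, h⟩

theorem hd_const {F : Type*} [CommSemiring F] {n : ℕ} (c : F) (k : ℕ) :
    HasDegLE (fun _ : Fin n → F => c) k :=
  ⟨MvPolynomial.C c, by simp, by simp⟩

theorem hd_var {F : Type*} [CommSemiring F] {n : ℕ} (i : Fin n) :
    HasDegLE (fun a : Fin n → F => a i) 1 :=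
  ⟨MvPolynomial.X i, by
    rw [MvPolynomial.X]
    refine (MvPolynomial.totalDegree_monomial_le _ _).trans ?_
    simp, by simp⟩

theorem hd_add {F : Type*} [CommSemiring F] {n : ℕ} {f g : (Fin n → F) → F} {k : ℕ}
    (hf : HasDegLE f k) (hg : HasDegLE g k) : HasDegLE (fun a => f a + g a) k := by
  obtain ⟨q, hq, h⟩ := hf
  obtain ⟨r, hr, h'⟩ := hg
  exact ⟨q + r, (MvPolynomial.totalDegree_add _ _).trans (max_le hq hr), by simp [h, h']⟩

theorem hd_mul {F : Type*} [CommSemiring F] {n : ℕ} {f g : (Fin n → F) → F} {k l : ℕ}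
    (hf : HasDegLE f k) (hg : HasDegLE g l) : HasDegLE (fun a => f a * g a) (k + l) := by
  obtain ⟨q, hq, h⟩ := hf
  obtain ⟨r, hr, h'⟩ := hg
  exact ⟨q * r, (MvPolynomial.totalDegree_mul _ _).trans (add_le_add hq hr), by simp [h, h']⟩

theorem hd_pow {F : Type*} [CommSemiring F] {n : ℕ} {f : (Fin n → F) → F} {k : ℕ}
    (hf : HasDegLE f k) (e : ℕ) : HasDegLE (fun a => f a ^ e) (e * k) := by
  induction e with
  | zero => simpa using hd_const (F := F) (n := n) 1 0
  | succ e ih => simpa [pow_succ, add_mul] using hd_mul ih hf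

theorem hd_sum {F ι : Type*} [CommSemiring F] {n : ℕ} {f : ι → (Fin n → F) → F} {k : ℕ}
    (s : Finset ι) (hf : ∀ i ∈ s, HasDegLE (f i) k) : HasDegLE (fun a => ∑ i ∈ s, f i a) k := by
  classical
  induction s using Finset.induction_on with
  | empty => simpa using hd_const (F := F) (n := n) 0 k
  | insert i s hi ih =>
    simp only [Finset.sum_insert hi]
    exact hd_add (hf i (by simp)) (ih fun j hj => hf j (by simp [hj]))

theorem hd_prod {F ι : Type*} [CommSemiring F] {n : ℕ} {f : ι → (Fin n → F) → F} {k : ι → ℕ}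
    (s : Finset ι) (hf : ∀ i ∈ s, HasDegLE (f i) (k i)) :
    HasDegLE (fun a => ∏ i ∈ s, f i a) (∑ i ∈ s, k i) := by
  classical
  induction s using Finset.induction_on with
  | empty => simpa using hd_const (F := F) (n := n) 1 0
  | insert i s hi ih =>
    simp only [Finset.sum_insert hi, Finset.prod_insert hi]
    exact hd_mul (hf i (by simp)) (ih fun j hj => hf j (by simp [hj]))

theorem deg_le_of_mem {F : Type*} [CommSemiring F] {n k : ℕ} {q : MvPolynomial (Fin n) F}
    (hq : q.totalDegree ≤ k) {b : Fin n →₀ ℕ} (hb : b ∈ q.support) : ∑ i, b i ≤ k := by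
  have := MvPolynomial.le_totalDegree hb
  rw [Finsupp.sum_fintype _ _ (by simp)] at this
  exact this.trans hq

theorem hd_comp {F : Type*} [CommSemiring F] {n m k l : ℕ} {f : (Fin n → F) → F}
    {g : Fin n → (Fin m → F) → F} (hf : HasDegLE f k) (hg : ∀ i, HasDegLE (g i) l) :
    HasDegLE (fun a => f fun i => g i a) (k * l) := by
  obtain ⟨q, hq, h⟩ := hf
  simp only [← h, MvPolynomial.eval_eq']
  refine hd_sum _ fun b hb => ?_
  have h1 := hd_mul (hd_const (n := m) (q.coeff b) 0)
    (hd_prod (f := fun i a => g i a ^ b i) univ fun i _ => hd_pow (hg i) (b i))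
  refine hd_mono h1 ?_
  rw [zero_add, ← Finset.sum_mul]
  exact Nat.mul_le_mul_right _ (deg_le_of_mem hq hb)

theorem exists_hd {F : Type*} [Field F] [Finite F] {n : ℕ} (f : (Fin n → F) → F) :
    ∃ k, HasDegLE f k := by
  obtain ⟨q, -, hq⟩ : f ∈ (MvPolynomial.restrictDegree (Fin n) F (Nat.card F - 1)).map
      (MvPolynomial.evalₗ F (Fin n)) := by
    have := Fintype.ofFinite F
    rw [Nat.card_eq_fintype_card, MvPolynomial.map_restrict_dom_evalₗ]
    trivial
  exact ⟨q.totalDegree, q, le_rfl, fun a => by rw [← hq]; rfl⟩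

theorem polar_aux {F : Type*} [CommRing F] {d e : ℕ} (φ : Fin e → Fin d) :
    ∑ S : Finset (Fin d), (-1 : F) ^ #(univ \ S) * (∏ l, if φ l ∈ S then 1 else 0) =
      if Function.Surjective φ then 1 else 0 := by
  classical
  have h := Finset.prod_add (fun _ : Fin d => (1 : F))
    (fun j => if ∃ l, φ l = j then 0 else -1) univ
  have h2 : ∏ j : Fin d, ((1 : F) + if ∃ l, φ l = j then 0 else -1) =
      if Function.Surjective φ then 1 else 0 := by
    split_ifs with hs
    · exact Finset.prod_eq_one fun j _ => by simp [hs j]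
    · simp only [Function.Surjective, not_forall] at hs
      obtain ⟨j, hj⟩ := hs
      exact Finset.prod_eq_zero (mem_univ j) (by rw [if_neg hj]; ring)
  rw [← h2, h, Finset.powerset_univ]
  refine Finset.sum_congr rfl fun S _ => ?_
  rw [Finset.prod_const_one, one_mul]
  by_cases hS : ∀ l, φ l ∈ S
  · rw [Finset.prod_eq_one (fun l _ => by simp [hS l]), mul_one, ← Finset.prod_const]
    refine Finset.prod_congr rfl fun j hj => ?_
    rw [if_neg]
    rintro ⟨l, rfl⟩
    simp [hS l] at hj
  · push Not at hS
    obtain ⟨l, hl⟩ := hS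
    rw [Finset.prod_eq_zero (mem_univ l) (by simp [hl]), mul_zero, eq_comm]
    exact Finset.prod_eq_zero (i := φ l) (by simp [hl]) (by simp)

theorem polar {F σ : Type*} [CommRing F] [DecidableEq σ] {d e : ℕ} (hed : e ≤ d)
    (i : Fin d → σ) (b : Fin e → σ) (t : Fin d → F) :
    ∑ S : Finset (Fin d), (-1 : F) ^ #(univ \ S) *
      (∏ l, ∑ j ∈ S, if i j = b l then t j else 0) =
    (Nat.card {φ : Fin e → Fin d // Function.Surjective φ ∧ i ∘ φ = b} : F) * ∏ j, t j := by
  classical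
  have h1 : ∀ S : Finset (Fin d), (∏ l, ∑ j ∈ S, if i j = b l then t j else 0) =
      ∑ φ : Fin e → Fin d, (∏ l, if φ l ∈ S then 1 else 0) *
        ∏ l, if i (φ l) = b l then t (φ l) else 0 := by
    intro S
    have : ∀ l, (∑ j ∈ S, if i j = b l then t j else 0) =
        ∑ j, (if j ∈ S then 1 else 0) * if i j = b l then t j else 0 := by
      intro l
      simp only [ite_mul, one_mul, zero_mul]
      rw [Finset.sum_ite_mem, Finset.univ_inter]
    simp only [this]
    rw [Finset.prod_univ_sum, Fintype.piFinset_univ]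
    simp only [Finset.prod_mul_distrib]
  simp only [h1, Finset.mul_sum]
  rw [Finset.sum_comm]
  simp only [← mul_assoc, ← Finset.sum_mul, polar_aux]
  rw [Nat.card_eq_fintype_card, Fintype.card_subtype, Finset.card_eq_sum_ones, Finset.sum_filter,
    Nat.cast_sum, Finset.sum_mul]
  refine Finset.sum_congr rfl fun φ _ => ?_
  by_cases hs : Function.Surjective φ
  · have hed' : e = d := le_antisymm hed (by simpa using Fintype.card_le_of_surjective φ hs)
    subst hed'
    have hb : Function.Bijective φ := ⟨Finite.injective_iff_surjective.2 hs, hs⟩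
    by_cases hi : i ∘ φ = b
    · subst hi
      simp [hs, hb.prod_comp t]
    · have : ∃ l, i (φ l) ≠ b l := by
        by_contra! hh
        exact hi (funext hh)
      obtain ⟨l, hl⟩ := this
      rw [Finset.prod_eq_zero (mem_univ l) (by simp [hl])]
      simp [hi]
  · simp [hs]

theorem exists_enum {σ : Type*} {r : ℕ} (s : Multiset σ) (hs : s.card = r) :
    ∃ b : Fin r → σ, Multiset.map b univ.val = s := by
  induction s using Quot.inductionOn with
  | h l =>
    have : l.length = r := by simpa using hs
    subst this
    exact ⟨l.get, by simp⟩

theorem exists_enum' {n r : ℕ} (α : Fin n →₀ ℕ) (hs : ∑ i, α i = r) :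
    ∃ b : Fin r → Fin n, Multiset.map b univ.val = Finsupp.toMultiset α :=
  exists_enum _ (by
    rw [Finsupp.card_toMultiset, Finsupp.sum_fintype _ _ (by simp)]; exact hs)

theorem enum_prod {F : Type*} [CommSemiring F] {n r : ℕ} {α : Fin n →₀ ℕ} {b : Fin r → Fin n}
    (hb : Multiset.map b univ.val = Finsupp.toMultiset α) (x : Fin n → F) :
    ∏ i, x i ^ α i = ∏ l, x (b l) := by
  have h : ((Finsupp.toMultiset α).map x).prod = ∏ i, x i ^ α i := by
    rw [Finsupp.toMultiset_map, Finsupp.prod_toMultiset, Finsupp.prod_mapDomain_index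
      (by simp) (by simp [pow_add]), Finsupp.prod_fintype _ _ (by simp)]
  rw [← h, ← hb, Multiset.map_map]
  rfl

theorem card_ne {p n d : ℕ} [hp : Fact p.Prime] (i : Fin d → Fin n)
    (hi : ∀ s, Multiset.count s (Multiset.map i univ.val) < p) :
    (Nat.card {φ : Fin d → Fin d // Function.Surjective φ ∧ i ∘ φ = i} : ZMod p) ≠ 0 := by
  classical
  have e : {φ : Fin d → Fin d // Function.Surjective φ ∧ i ∘ φ = i} ≃
      {g : Equiv.Perm (Fin d) // i ∘ g = i} :=
    { toFun := fun φ => ⟨Equiv.ofBijective φ.1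
        ⟨Finite.injective_iff_surjective.2 φ.2.1, φ.2.1⟩, φ.2.2⟩
      invFun := fun g => ⟨g.1, g.1.surjective, g.2⟩
      left_inv := fun φ => rfl
      right_inv := fun g => by ext; rfl }
  rw [Nat.card_congr e, Nat.card_eq_fintype_card, DomMulAct.stabilizer_card, Nat.cast_prod,
    Finset.prod_ne_zero_iff]
  intro s _
  rw [Ne, ZMod.natCast_eq_zero_iff, hp.out.dvd_factorial, not_le]
  refine lt_of_eq_of_lt ?_ (hi s)
  rw [Multiset.count_map, Fintype.card_subtype]
  simp [Finset.card, eq_comm]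

theorem exists_top {p n k : ℕ} [hp : Fact p.Prime] {f : (Fin n → ZMod p) → ZMod p}
    {q : MvPolynomial (Fin n) (ZMod p)} (hq : q.totalDegree ≤ k + 1)
    (h : ∀ a, MvPolynomial.eval a q = f a) (hf : ¬ HasDegLE f k) :
    ∃ α ∈ q.support, ∑ i, α i = k + 1 ∧ ∀ i, α i < p := by
  by_contra! hc
  apply hf
  have hfe : f = fun a => ∑ b ∈ q.support, q.coeff b * ∏ i, a i ^ b i := by
    funext a
    rw [← h, MvPolynomial.eval_eq']
  rw [hfe]
  refine hd_sum _ fun b hb => ?_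
  rw [← zero_add k]
  refine hd_mul (hd_const _ 0) ?_
  have hle := deg_le_of_mem hq hb
  have key : ∀ c : Fin n → ℕ, HasDegLE (fun a : Fin n → ZMod p => ∏ i, a i ^ c i) (∑ i, c i) := by
    intro c
    exact hd_prod _ fun i _ => by simpa using hd_pow (hd_var i) (c i)
  by_cases hlt : ∑ i, b i ≤ k
  · exact hd_mono (key b) hlt
  · obtain ⟨j, hj⟩ := hc b hb (by omega)
    have h2 := hp.out.two_le
    have hsum : ∑ i, Function.update (b : Fin n → ℕ) j (b j - (p - 1)) i ≤ k := by
      rw [Finset.sum_update_of_mem (mem_univ j)]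
      have := Finset.sum_erase_add univ (b : Fin n → ℕ) (mem_univ j)
      rw [Finset.sdiff_singleton_eq_erase]
      omega
    refine hd_mono (l := k) ?_ hsum |> id
    convert key (Function.update (b : Fin n → ℕ) j (b j - (p - 1))) using 1
    funext a
    refine Finset.prod_congr rfl fun i _ => ?_
    by_cases hij : i = j
    · subst hij
      rw [Function.update_self]
      obtain ⟨c, hc⟩ := Nat.exists_eq_add_of_le hj
      have e1 : b i = p + c := hc
      have e2 : b i - (p - 1) = 1 + c := by omega
      rw [e2, e1, pow_add, pow_add, ZMod.pow_card, pow_one]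
    · rw [Function.update_of_ne hij]

/-- The `m+1`-ary part of a nonempty stable class is a submodule. -/
def partK {p : ℕ} [Fact p.Prime] (K : Set (OpSig (ZMod p) (ZMod p)))
    (h1 : classComp K (affineClass (ZMod p)) ⊆ K)
    (h2 : classComp (affineClass (ZMod p)) K ⊆ K) (hK : K.Nonempty) (m : ℕ) :
    Submodule (ZMod p) ((Fin (m + 1) → ZMod p) → ZMod p) where
  carrier := {g | (⟨m, g⟩ : OpSig _ _) ∈ K}
  add_mem' := by
    intro f g hf hg
    refine h2 ⟨1, m, fun x => x 0 + x 1, ![f, g], ?_, ?_, ?_⟩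
    · exact hd_add (hd_var 0) (hd_var 1)
    · intro i
      fin_cases i
      · exact hf
      · exact hg
    · rfl
  zero_mem' := by
    obtain ⟨⟨n, f⟩, hf⟩ := hK
    have h3 : (⟨m, fun _ => f fun _ => 0⟩ : OpSig (ZMod p) (ZMod p)) ∈ K :=
      h1 ⟨n, m, f, fun _ _ => 0, hf, fun _ => hd_const 0 1, rfl⟩
    exact h2 ⟨0, m, fun _ => 0, fun _ => _, hd_const 0 1, fun _ => h3, rfl⟩
  smul_mem' := by
    intro c f hf
    refine h2 ⟨0, m, fun x => c * x 0, fun _ => f, ?_, fun _ => hf, rfl⟩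
    have h3 := hd_mul (hd_const c 0) (hd_var (F := ZMod p) (0 : Fin 1))
    rw [zero_add] at h3
    exact h3

theorem const_sub {p : ℕ} [Fact p.Prime] (K : Set (OpSig (ZMod p) (ZMod p)))
    (h1 : classComp K (affineClass (ZMod p)) ⊆ K)
    (h2 : classComp (affineClass (ZMod p)) K ⊆ K) (hK : K.Nonempty) :
    degClass (ZMod p) 0 ⊆ K := by
  rintro ⟨m, g⟩ hgm
  obtain ⟨q, hq, hg⟩ : HasDegLE g 0 := hgm
  have hz : (0 : (Fin (m + 1) → ZMod p) → ZMod p) ∈ partK K h1 h2 hK m := zero_mem _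
  have hq' := MvPolynomial.totalDegree_eq_zero_iff_eq_C.1 (Nat.le_zero.1 hq)
  have : g = fun _ => q.coeff 0 := by
    funext a
    rw [← hg, hq']
    simp
  subst this
  exact h2 ⟨0, m, fun _ => q.coeff 0, fun _ => _, hd_const _ 1, fun _ => hz, rfl⟩

theorem opProd_mem {p : ℕ} [Fact p.Prime] (K : Set (OpSig (ZMod p) (ZMod p)))
    (h1 : classComp K (affineClass (ZMod p)) ⊆ K)
    (h2 : classComp (affineClass (ZMod p)) K ⊆ K) {n k : ℕ}
    {f : (Fin (n + 1) → ZMod p) → ZMod p} (hfK : (⟨n, f⟩ : OpSig _ _) ∈ K)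
    (hf : HasDegLE f (k + 1)) (hf' : ¬ HasDegLE f k) :
    (⟨k, fun t => ∏ j, t j⟩ : OpSig (ZMod p) (ZMod p)) ∈ K := by
  classical
  have hK : K.Nonempty := ⟨_, hfK⟩
  obtain ⟨q, hq, h⟩ := hf
  obtain ⟨α, hα, hαs, hαp⟩ := exists_top hq h hf'
  obtain ⟨i, hi⟩ := exists_enum' α hαs
  have hmem : (fun t : Fin (k + 1) → ZMod p => ∑ S : Finset (Fin (k + 1)),
      (-1 : ZMod p) ^ #(univ \ S) * f fun s => ∑ j ∈ S, if i j = s then t j else 0) ∈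
      partK K h1 h2 hK k := by
    have : ∀ S ∈ (univ : Finset (Finset (Fin (k + 1)))), ((-1 : ZMod p) ^ #(univ \ S)) •
        (fun t : Fin (k + 1) → ZMod p => f fun s => ∑ j ∈ S, if i j = s then t j else 0) ∈
        partK K h1 h2 hK k := by
      intro S _
      refine Submodule.smul_mem _ _ (h1 ⟨n, k, f, fun s t => ∑ j ∈ S, if i j = s then t j else 0,
        hfK, fun s => ?_, rfl⟩)
      refine hd_sum _ fun j _ => ?_
      split_ifs
      · exact hd_var j
      · exact hd_const 0 1
    have h3 := Submodule.sum_mem _ this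
    convert h3 using 1
    funext t
    simp
  set c : ZMod p := q.coeff α *
    (Nat.card {φ : Fin (k + 1) → Fin (k + 1) // Function.Surjective φ ∧ i ∘ φ = i} : ZMod p)
    with hc
  have hc0 : c ≠ 0 := by
    refine mul_ne_zero (MvPolynomial.mem_support_iff.1 hα) (card_ne i fun s => ?_)
    rw [hi, Finsupp.count_toMultiset]
    exact hαp s
  have heq : (fun t : Fin (k + 1) → ZMod p => ∑ S : Finset (Fin (k + 1)),
      (-1 : ZMod p) ^ #(univ \ S) * f fun s => ∑ j ∈ S, if i j = s then t j else 0) =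
      c • fun t => ∏ j, t j := by
    funext t
    simp only [← h, MvPolynomial.eval_eq', Finset.mul_sum, Pi.smul_apply, smul_eq_mul]
    rw [Finset.sum_comm, Finset.sum_eq_single_of_mem α hα]
    · simp only [enum_prod hi, mul_left_comm _ (q.coeff α)]
      rw [← Finset.mul_sum, polar le_rfl, hc, mul_assoc]
    · intro β hβ hne
      obtain ⟨b, hb⟩ := exists_enum' β rfl
      simp only [enum_prod hb, mul_left_comm _ (q.coeff β)]
      rw [← Finset.mul_sum, polar (deg_le_of_mem hq hβ)]
      have : IsEmpty {φ : Fin (∑ i, β i) → Fin (k + 1) //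
          Function.Surjective φ ∧ i ∘ φ = b} := by
        refine ⟨fun ⟨φ, hs, hφ⟩ => hne ?_⟩
        have hle : k + 1 ≤ ∑ i, β i := by simpa using Fintype.card_le_of_surjective φ hs
        have hcard : Fintype.card (Fin (∑ i, β i)) = Fintype.card (Fin (k + 1)) := by
          simpa using le_antisymm (deg_le_of_mem hq hβ) hle
        have hbij : Function.Bijective φ := (Fintype.bijective_iff_surjective_and_card φ).2
          ⟨hs, hcard⟩
        suffices hm : Finsupp.toMultiset β = Finsupp.toMultiset α by
          ext s
          rw [← Finsupp.count_toMultiset, hm, Finsupp.count_toMultiset]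
        rw [← hb, ← hi, ← hφ, ← Multiset.map_map]
        congr 1
        exact Multiset.map_univ_val_equiv (Equiv.ofBijective φ hbij)
      simp
  rw [heq] at hmem
  have := Submodule.smul_mem _ c⁻¹ hmem
  rwa [smul_smul, inv_mul_cancel₀ hc0, one_smul] at this

theorem exists_factors {F : Type*} [CommSemiring F] {m : ℕ} (r : ℕ) (s : Multiset (Fin m))
    (hs : s.card ≤ r) : ∃ g : Fin r → (Fin m → F) → F, (∀ j, HasDegLE (g j) 1) ∧
      ∀ a, ∏ j, g j a = (s.map a).prod := by
  induction r generalizing s with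
  | zero =>
    have : s = 0 := by simpa using hs
    subst this
    exact ⟨fun _ _ => 1, fun _ => hd_const 1 1, by simp⟩
  | succ r ih =>
    induction s using Multiset.induction_on with
    | empty => exact ⟨fun _ _ => 1, fun _ => hd_const 1 1, by simp⟩
    | cons x s _ =>
      obtain ⟨g, hg, hg'⟩ := ih s (by simpa using hs)
      refine ⟨Fin.cons (fun a => a x) g, ?_, ?_⟩
      · intro j
        refine Fin.cases ?_ (fun j => ?_) j
        · exact hd_var x
        · simpa using hg j
      · intro a
        simp [Fin.prod_univ_succ, hg']

theorem degClass_sub {p : ℕ} [Fact p.Prime] (K : Set (OpSig (ZMod p) (ZMod p)))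
    (h1 : classComp K (affineClass (ZMod p)) ⊆ K)
    (h2 : classComp (affineClass (ZMod p)) K ⊆ K) {k : ℕ}
    (hk : (⟨k, fun t => ∏ j, t j⟩ : OpSig (ZMod p) (ZMod p)) ∈ K) :
    degClass (ZMod p) (k + 1) ⊆ K := by
  have hK : K.Nonempty := ⟨_, hk⟩
  rintro ⟨m, g⟩ hgm
  obtain ⟨q, hq, hg⟩ : HasDegLE g (k + 1) := hgm
  change g ∈ partK K h1 h2 hK m
  have : g = ∑ b ∈ q.support, q.coeff b • fun a : Fin (m + 1) → ZMod p => ∏ i, a i ^ b i := by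
    funext a
    rw [← hg, MvPolynomial.eval_eq']
    simp
  rw [this]
  refine Submodule.sum_mem _ fun b hb => Submodule.smul_mem _ _ ?_
  have hle := deg_le_of_mem hq hb
  obtain ⟨e, he⟩ := exists_enum' b rfl
  obtain ⟨u, hu, hu'⟩ := exists_factors (F := ZMod p) (k + 1) (Multiset.map e univ.val)
    (by simpa using hle)
  refine h1 ⟨k, m, _, u, hk, hu, ?_⟩
  congr 1
  funext a
  rw [hu', enum_prod he, Multiset.map_map]
  rfl

theorem degClass_sub' {p : ℕ} [Fact p.Prime] (K : Set (OpSig (ZMod p) (ZMod p)))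
    (h1 : classComp K (affineClass (ZMod p)) ⊆ K)
    (h2 : classComp (affineClass (ZMod p)) K ⊆ K) {k : ℕ}
    (hk : ¬ K ⊆ degClass (ZMod p) k) : degClass (ZMod p) (k + 1) ⊆ K := by
  classical
  obtain ⟨⟨n, f⟩, hfK, hf⟩ := Set.not_subset.1 hk
  have hf : ¬ HasDegLE f k := hf
  have hex := exists_hd f
  obtain ⟨d, hd, hmin⟩ : ∃ d, HasDegLE f d ∧ ∀ e < d, ¬ HasDegLE f e :=
    ⟨Nat.find hex, Nat.find_spec hex, fun e he => Nat.find_min hex he⟩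
  have hkd : k < d := by
    by_contra hh
    exact hf (hd_mono hd (by omega))
  obtain ⟨d, rfl⟩ : ∃ e, d = e + 1 := ⟨d - 1, by omega⟩
  have := degClass_sub K h1 h2 (opProd_mem K h1 h2 hfK hd (hmin d (by omega)))
  exact fun x hx => this (hd_mono hx (by omega))

end helpers

/-- Over `GF(p)` with `p` prime, the `L`-stable classes are exactly: the empty
set, the classes `D_k` for `k ∈ ℕ`, and the class of all operations. -/
theorem lStable_iff {p : ℕ} [Fact p.Prime] (K : Set (OpSig (ZMod p) (ZMod p))) :
    (classComp K (affineClass (ZMod p)) ⊆ K ∧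
      classComp (affineClass (ZMod p)) K ⊆ K) ↔
    (K = ∅ ∨ (∃ k : ℕ, K = degClass (ZMod p) k) ∨ K = Set.univ) := by
  classical
  constructor
  · rintro ⟨h1, h2⟩
    rcases K.eq_empty_or_nonempty with hK | hK
    · exact Or.inl hK
    refine Or.inr ?_
    by_cases hb : ∃ k, K ⊆ degClass (ZMod p) k
    · refine Or.inl ⟨Nat.find hb, Set.Subset.antisymm (Nat.find_spec hb) ?_⟩
      rcases hn : Nat.find hb with _ | k
      · exact const_sub K h1 h2 hK
      · exact degClass_sub' K h1 h2 (Nat.find_min hb (by omega))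
    · push Not at hb
      refine Or.inr (Set.eq_univ_of_forall fun g => ?_)
      obtain ⟨k, hk⟩ := exists_hd g.2
      exact degClass_sub' K h1 h2 (hb k) (hd_mono hk (Nat.le_succ k))
  · rintro (rfl | ⟨k, rfl⟩ | rfl)
    · constructor
      · rintro _ ⟨n, m, f, g, hf, hg, rfl⟩
        exact hf
      · rintro _ ⟨n, m, f, g, hf, hg, rfl⟩
        exact (hg 0).elim
    · constructor
      · rintro _ ⟨n, m, f, g, hf, hg, rfl⟩
        have := hd_comp (k := k) (l := 1) (f := f) (g := g) hf hg
        rwa [mul_one] at this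
      · rintro _ ⟨n, m, f, g, hf, hg, rfl⟩
        have := hd_comp (k := 1) (l := k) (f := f) (g := g) hf hg
        rwa [one_mul] at this
    · exact ⟨Set.subset_univ _, Set.subset_univ _⟩
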